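/- Assume I is differentiable on (0, x*), a* < log m − I(θx*), and a ∈ (a*, log m − I(θx*)), and let c̄ = c̄(L) be the unique solution of F_L(c) = 0 in (0, (1−θ)x*/(L + x*)). Then F_L(c̄ − δ) > 0 for every δ ∈ (0, c̄), and F_L(c̄ + δ) < 0 for every δ ∈ (0, 1 − c̄). -/

import Mathlib

open MeasureTheory Filter Set Topology

open scoped Classical in
/-- Cumulant generating function valued in `EReal` (equal to `+∞` where the
moment generating function is infinite). -/
noncomputable def cgfE {Ω : Type*} [MeasurableSpace Ω] (μ : Measure Ω) (X : Ω → ℝ) (t : ℝ) :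
    EReal :=
  if Integrable (fun ω => Real.exp (t * X ω)) μ then
    ((Real.log (∫ ω, Real.exp (t * X ω) ∂μ) : ℝ) : EReal)
  else ⊤

/-- Real-valued version of the cumulant generating function (meaningful where the
moment generating function is finite). -/
noncomputable def cgfR {Ω : Type*} [MeasurableSpace Ω] (μ : Measure Ω) (X : Ω → ℝ) (t : ℝ) :
    ℝ :=
  Real.log (∫ ω, Real.exp (t * X ω) ∂μ)

/-- The Cramér (Legendre) rate function `I(x) = sup_t (t x - Λ(t))`, valued in `[0,∞]`. -/
noncomputable def rateI {Ω : Type*} [MeasurableSpace Ω] (μ : Measure Ω) (X : Ω → ℝ) (x : ℝ) :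
    EReal :=
  ⨆ t : ℝ, (((t * x : ℝ) : EReal) - cgfE μ X t)

/-- `λ* = sup {λ ≥ 0 : E[exp(λ X)] < ∞}`, valued in `EReal`. -/
noncomputable def lamStar {Ω : Type*} [MeasurableSpace Ω] (μ : Measure Ω) (X : Ω → ℝ) :
    EReal :=
  sSup {l : EReal | ∃ lr : ℝ, l = (lr : EReal) ∧ 0 ≤ lr ∧
    Integrable (fun ω => Real.exp (lr * X ω)) μ}

/-- `x* = sup {x ≥ 0 : I(x) ≤ log m}`. -/
noncomputable def xStar {Ω : Type*} [MeasurableSpace Ω] (μ : Measure Ω) (X : Ω → ℝ)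
    (m : ℝ) : ℝ :=
  sSup {x : ℝ | 0 ≤ x ∧ rateI μ X x ≤ ((Real.log m : ℝ) : EReal)}

/-- `a* = min{(log m − I(x*))·(L+θx*)/(L+x*) + ((1−θ)x*/(L+x*))·log b , log m − I(θx*)}`. -/
noncomputable def aStar {Ω : Type*} [MeasurableSpace Ω] (μ : Measure Ω) (X : Ω → ℝ)
    (m θ L : ℝ) (b : ℕ) : ℝ :=
  min ((Real.log m - (rateI μ X (xStar μ X m)).toReal) *
        (L + θ * xStar μ X m) / (L + xStar μ X m) +
        ((1 - θ) * xStar μ X m / (L + xStar μ X m)) * Real.log b)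
      (Real.log m - (rateI μ X (θ * xStar μ X m)).toReal)

/-- `F_L(c) = log m − I((θx* + Lc)/(1−c)) − (a − c log b)/(1−c)`, valued in `[-∞,∞)`. -/
noncomputable def fL {Ω : Type*} [MeasurableSpace Ω] (μ : Measure Ω) (X : Ω → ℝ)
    (m θ L : ℝ) (b : ℕ) (a c : ℝ) : EReal :=
  ((Real.log m : ℝ) : EReal) - rateI μ X ((θ * xStar μ X m + L * c) / (1 - c)) -
    (((a - c * Real.log b) / (1 - c) : ℝ) : EReal)

theorem rateI_le_coe_iff {Ω : Type*} [MeasurableSpace Ω] (μ : Measure Ω) (X : Ω → ℝ)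
    (x r : ℝ) :
    rateI μ X x ≤ (r : EReal) ↔
      ∀ t : ℝ, Integrable (fun ω => Real.exp (t * X ω)) μ → t * x - cgfR μ X t ≤ r := by
  unfold rateI
  rw [iSup_le_iff]
  refine forall_congr' fun t => ?_
  by_cases h : Integrable (fun ω => Real.exp (t * X ω)) μ
  · simp only [cgfE, h, if_true, cgfR, forall_true_left]
    exact_mod_cast Iff.rfl
  · simp [cgfE, h]

/-- Convexity of the rate function, with unnormalised weights. -/
theorem rateI_le_coe_of_weighted {Ω : Type*} [MeasurableSpace Ω] {μ : Measure Ω} {X : Ω → ℝ}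
    {p q u v x r s w : ℝ} (hp : 0 ≤ p) (hq : 0 ≤ q) (hpq : 0 < p + q)
    (hx : p * u + q * v = (p + q) * x) (hw : p * r + q * s = (p + q) * w)
    (hu : rateI μ X u ≤ (r : EReal)) (hv : rateI μ X v ≤ (s : EReal)) :
    rateI μ X x ≤ (w : EReal) := by
  rw [rateI_le_coe_iff] at *
  intro t ht
  have h1 := mul_le_mul_of_nonneg_left (hu t ht) hp
  have h2 := mul_le_mul_of_nonneg_left (hv t ht) hq
  refine le_of_mul_le_mul_left ?_ hpq
  linear_combination h1 + h2 - t * hx + hw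

theorem EReal.coe_sub_sub_coe_pos_iff (A B : ℝ) (I : EReal) :
    0 < (A : EReal) - I - (B : EReal) ↔ I < ((A - B : ℝ) : EReal) := by
  induction I with
  | bot => simp [-EReal.coe_sub]
  | top => simp
  | coe r =>
    norm_cast
    constructor <;> intro h <;> linarith

theorem EReal.coe_sub_sub_coe_nonneg_iff (A B : ℝ) (I : EReal) :
    0 ≤ (A : EReal) - I - (B : EReal) ↔ I ≤ ((A - B : ℝ) : EReal) := by
  induction I with
  | bot => simp
  | top => simp [-EReal.coe_sub]
  | coe r =>
    norm_cast
    constructor <;> intro h <;> linarith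

/-- `c ↦ (1 - c) F_L(c)` is concave and positive at `0`, so it is positive to the left of any
point where it is nonnegative. -/
theorem fL_pos_of_lt_of_nonneg {Ω : Type*} [MeasurableSpace Ω] {μ : Measure Ω} {X : Ω → ℝ}
    {m θ L a c d : ℝ} {b : ℕ} (hI : rateI μ X (θ * xStar μ X m) ≠ ⊤)
    (ha : a < Real.log m - (rateI μ X (θ * xStar μ X m)).toReal)
    (hc : 0 < c) (hcd : c < d) (hd : d < 1) (hF : 0 ≤ fL μ X m θ L b a d) :
    0 < fL μ X m θ L b a c := by
  unfold fL at *
  rw [EReal.coe_sub_sub_coe_nonneg_iff] at hF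
  rw [EReal.coe_sub_sub_coe_pos_iff]
  have h0 := EReal.le_coe_toReal hI
  set y := θ * xStar μ X m
  set s := (rateI μ X y).toReal
  set l := Real.log b
  set r := Real.log m - (a - d * l) / (1 - d) with hr
  have hc1 : 0 < 1 - c := by linarith
  have hd1 : 0 < 1 - d := by linarith
  have hd0 : 0 < d := by linarith
  have hsum : c * (1 - d) + (d - c) = d * (1 - c) := by ring
  have hdc : 0 < d * (1 - c) := mul_pos hd0 hc1
  have key := rateI_le_coe_of_weighted (p := c * (1 - d)) (q := d - c)
    (x := (y + L * c) / (1 - c)) (w := (c * (1 - d) * r + (d - c) * s) / (d * (1 - c)))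
    (mul_pos hc hd1).le (sub_pos.2 hcd).le (hsum ▸ hdc)
    (by rw [hsum]; field_simp; ring) (by rw [hsum, mul_div_cancel₀ _ hdc.ne']) hF h0
  refine key.trans_lt (EReal.coe_lt_coe_iff.2 ?_)
  have hgap := mul_pos (sub_pos.2 hcd) (sub_pos.2 ha)
  rw [div_lt_iff₀ hdc]
  have e1 : c * (1 - d) * r = c * (1 - d) * Real.log m - c * (a - d * l) := by
    rw [hr]; field_simp
  have e2 : (Real.log m - (a - c * l) / (1 - c)) * (d * (1 - c)) =
      d * (1 - c) * Real.log m - d * (a - c * l) := by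
    field_simp
  rw [e1, e2]
  linarith

theorem stmt17 {Ω : Type*} [MeasurableSpace Ω] (μ : Measure Ω) [IsProbabilityMeasure μ]
    (X : Ω → ℝ) (hmeas : Measurable X) (hint : Integrable X μ)
    (hmean : ∫ ω, X ω ∂μ = 0) (hX0 : μ {ω | X ω = 0} < 1)
    (hmom : ∃ κ : ℝ, 0 < κ ∧ Integrable (fun ω => Real.exp (κ * X ω)) μ)
    (m θ L : ℝ) (b : ℕ) (hm : 1 < m) (hθ0 : 0 ≤ θ) (hθ1 : θ < 1)
    (hL : 0 < L) (hb : 2 ≤ b) (hbm : (b : ℝ) ≤ m)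
    (hxB : BddAbove {x : ℝ | 0 ≤ x ∧ rateI μ X x ≤ ((Real.log m : ℝ) : EReal)})
    (hxpos : 0 < xStar μ X m)
    (hIfin : ∀ x : ℝ, 0 < x → x ≤ xStar μ X m → rateI μ X x ≠ ⊤)
    (hIθfin : rateI μ X (θ * xStar μ X m) ≠ ⊤)
    (hIdiff : DifferentiableOn ℝ (fun x : ℝ => (rateI μ X x).toReal)
      (Set.Ioo 0 (xStar μ X m)))
    (a : ℝ)
    (hstar : aStar μ X m θ L b < Real.log m - (rateI μ X (θ * xStar μ X m)).toReal)
    (haL : aStar μ X m θ L b < a)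
    (haU : a < Real.log m - (rateI μ X (θ * xStar μ X m)).toReal)
    (cbar : ℝ) (hcbar : cbar ∈ Set.Ioo 0 ((1 - θ) * xStar μ X m / (L + xStar μ X m)))
    (hzero : fL μ X m θ L b a cbar = 0) :
    (∀ δ : ℝ, 0 < δ → δ < cbar → 0 < fL μ X m θ L b a (cbar - δ)) ∧
    (∀ δ : ℝ, 0 < δ → δ < 1 - cbar → fL μ X m θ L b a (cbar + δ) < 0) := by
  obtain ⟨hc0, hc2⟩ := hcbar
  have hc1 : cbar < 1 := by
    refine hc2.trans ((div_lt_one (by positivity)).2 ?_)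
    nlinarith
  refine ⟨fun δ h0 h1 => ?_, fun δ h0 h1 => ?_⟩
  · exact fL_pos_of_lt_of_nonneg hIθfin haU (by linarith) (by linarith) hc1 hzero.ge
  · by_contra! h
    exact (fL_pos_of_lt_of_nonneg hIθfin haU hc0 (by linarith) (by linarith) h).ne' hzero
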